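/- Let A be a finite subset of Λ \ {0}, S* a nested set in A, and b a ℤ-basis of Λ adapted to S*. Then for every B ∈ S* there exists λ ∈ b such that λ lies in the completion of ⟨B⟩_ℤ but, for every D ∈ S* with D ⊊ B, λ does not lie in the completion of ⟨D⟩_ℤ. -/

import Mathlib

open TensorProduct

variable {Λ : Type*} [AddCommGroup Λ]

/-- The completion (saturation) `Δ̄ = {λ ∈ Λ : m • λ ∈ Δ for some m > 0}` of a sublattice. -/
def completion (Δ : Submodule ℤ Λ) : Submodule ℤ Λ where
  carrier := {x | ∃ m : ℤ, 0 < m ∧ m • x ∈ Δ}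
  zero_mem' := ⟨1, one_pos, by rw [one_smul]; exact Δ.zero_mem⟩
  add_mem' := by
    rintro a b ⟨m, hm, hma⟩ ⟨k, hk, hkb⟩
    refine ⟨m * k, mul_pos hm hk, ?_⟩
    rw [show (m * k) • (a + b) = k • (m • a) + m • (k • b) by
      rw [smul_add, mul_comm m k, mul_smul, mul_smul, smul_comm k m b]]
    exact Δ.add_mem (Δ.smul_mem _ hma) (Δ.smul_mem _ hkb)
  smul_mem' := by
    rintro c x ⟨m, hm, hmx⟩
    exact ⟨m, hm, by rw [smul_comm]; exact Δ.smul_mem c hmx⟩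

/-- The completion of the sublattice spanned by a subset `B ⊆ Λ`. -/
def zcomp (B : Set Λ) : Submodule ℤ Λ := completion (Submodule.span ℤ B)

/-- An integral decomposition of `B`: the parts (the elements of the finite family `P`)
are pairwise disjoint and nonempty, they cover `B`, and the completion of `⟨B⟩ℤ` is the
internal direct sum of the completions of the spans of the parts. -/
def IsIntegralDecomp (B : Set Λ) (P : Finset (Set Λ)) : Prop :=
  (∀ p ∈ P, p.Nonempty) ∧
  ((P : Set (Set Λ)).Pairwise fun p q => Disjoint p q) ∧
  ⋃₀ (P : Set (Set Λ)) = B ∧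
  (zcomp B = ⨆ p ∈ P, zcomp p) ∧
  iSupIndep (fun p : P => zcomp (p : Set Λ))

/-- `B` is irreducible if it admits no integral decomposition with at least two parts. -/
def IrreducibleSubset (B : Set Λ) : Prop :=
  ¬ ∃ P : Finset (Set Λ), 2 ≤ P.card ∧ IsIntegralDecomp B P

/-- The set of elements of `Λ` lying in the `ℂ`-span of `B` inside `ℂ ⊗[ℤ] Λ`. -/
def inCSpan (B : Set Λ) : Set Λ :=
  {x : Λ | (1 : ℂ) ⊗ₜ[ℤ] x ∈ Submodule.span ℂ ((fun b : Λ => (1 : ℂ) ⊗ₜ[ℤ] b) '' B)}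

/-- `B` is complete in `A` if `B = A ∩ ⟨B⟩_ℂ`. -/
def IsCompleteIn (A B : Set Λ) : Prop := B = A ∩ inCSpan B

/-- A nested set in `A`: a family of nonempty irreducible subsets of `A` such that for every
pairwise incomparable (under inclusion) finite subfamily, the union of the subfamily is
complete in `A` and the subfamily consists exactly of the parts of the integral decomposition
of the union into irreducible subsets. -/
def IsNestedIn (A : Set Λ) (S : Set (Set Λ)) : Prop :=
  (∀ B ∈ S, B.Nonempty ∧ B ⊆ A ∧ IrreducibleSubset B) ∧
  ∀ F : Finset (Set Λ), ↑F ⊆ S → F.Nonempty →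
    ((F : Set (Set Λ)).Pairwise fun p q => ¬ p ⊆ q ∧ ¬ q ⊆ p) →
    IsCompleteIn A (⋃₀ ↑F) ∧ IsIntegralDecomp (⋃₀ ↑F) F

/-- A `ℤ`-basis of `Λ` (given as a subset that is linearly independent and spans) is
adapted to `S` if for every `B ∈ S` its intersection with the completion of `⟨B⟩ℤ`
is a `ℤ`-basis of that completion. -/
def IsAdaptedBasis (b : Set Λ) (S : Set (Set Λ)) : Prop :=
  LinearIndependent ℤ ((↑) : b → Λ) ∧ Submodule.span ℤ b = ⊤ ∧
  ∀ B ∈ S, LinearIndependent ℤ ((↑) : ↥(b ∩ (zcomp B : Set Λ)) → Λ) ∧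
    Submodule.span ℤ (b ∩ (zcomp B : Set Λ)) = zcomp B

variable [Module.Free ℤ Λ] [Module.Finite ℤ Λ]

/-- The completion of the span is monotone in the subset. -/
theorem zcomp_mono {Λ : Type*} [AddCommGroup Λ] {B C : Set Λ} (h : B ⊆ C) :
    zcomp B ≤ zcomp C := by
  rintro x ⟨m, hm, hx⟩
  exact ⟨m, hm, Submodule.span_mono h hx⟩

theorem subset_zcomp {Λ : Type*} [AddCommGroup Λ] (B : Set Λ) : B ⊆ zcomp B :=
  fun _ hx => ⟨1, one_pos, by rw [one_smul]; exact Submodule.subset_span hx⟩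

theorem zcomp_subset_inCSpan {Λ : Type*} [AddCommGroup Λ] (B : Set Λ) :
    (zcomp B : Set Λ) ⊆ inCSpan B := by
  rintro x ⟨m, hm, hx⟩
  have key : ∀ y ∈ Submodule.span ℤ B, y ∈ inCSpan B := by
    intro y hy
    induction hy using Submodule.span_induction with
    | mem y hy => exact Submodule.subset_span ⟨y, hy, rfl⟩
    | zero => simp [inCSpan]
    | add y z _ _ hy hz =>
      simp only [inCSpan, Set.mem_ofPred_eq, TensorProduct.tmul_add] at hy hz ⊢
      exact Submodule.add_mem _ hy hz
    | smul c y _ hy =>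
      simp only [inCSpan, Set.mem_ofPred_eq, TensorProduct.tmul_smul] at hy ⊢
      exact zsmul_mem hy c
  have hmx := key _ hx
  simp only [inCSpan, Set.mem_ofPred_eq, TensorProduct.tmul_smul] at hmx ⊢
  rw [← Int.cast_smul_eq_zsmul ℂ] at hmx
  exact (Submodule.smul_mem_iff _ (Int.cast_ne_zero.mpr hm.ne')).mp hmx

/-- If `b` is a `ℤ`-basis of `Λ` adapted to a nested set `S` in `A`, then for every `B ∈ S`
there is a basis element lying in the completion of `⟨B⟩ℤ` but in no completion of `⟨D⟩ℤ`
for `D ∈ S` properly contained in `B`. -/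
theorem adapted_basis_element_surjects
    (A : Set Λ) (hAfin : A.Finite) (hA0 : (0 : Λ) ∉ A)
    (S : Set (Set Λ)) (hS : IsNestedIn A S)
    (b : Set Λ) (hb : IsAdaptedBasis b S) :
    ∀ B ∈ S, ∃ l ∈ b, l ∈ zcomp B ∧ ∀ D ∈ S, D ⊂ B → l ∉ zcomp D := by
  intro B hB
  by_contra! hcon
  obtain ⟨⟨x, hxB⟩, hBA, hirr⟩ := hS.1 B hB
  have hspan := (hb.2.2 B hB).2
  have hSfin : {D | D ∈ S ∧ D ⊂ B}.Finite :=
    hAfin.finite_subsets.subset fun D hD => (hS.1 D hD.1).2.1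
  have hmax : {D | Maximal (fun D => D ∈ {D | D ∈ S ∧ D ⊂ B}) D}.Finite :=
    hSfin.subset fun D hD => hD.prop
  obtain ⟨F, hF⟩ := hmax.exists_finset_coe
  have hmemF : ∀ D, D ∈ F ↔ Maximal (fun D => D ∈ {D | D ∈ S ∧ D ⊂ B}) D := fun D => by
    rw [← Finset.mem_coe, hF]; rfl
  have hle : zcomp B ≤ zcomp (⋃₀ (F : Set (Set Λ))) := by
    rw [← hspan, Submodule.span_le]
    rintro l ⟨hlb, hlB⟩
    obtain ⟨D, hDS, hDB, hlD⟩ := hcon l hlb hlB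
    obtain ⟨M, hDM, hM⟩ := hSfin.exists_le_maximal (a := D) ⟨hDS, hDB⟩
    exact zcomp_mono (hDM.trans (Set.subset_sUnion_of_mem ((hmemF M).mpr hM))) hlD
  have hne : F.Nonempty := by
    by_contra hempty
    rw [Finset.not_nonempty_iff_eq_empty] at hempty
    obtain ⟨m, hm, hmx⟩ := hle (subset_zcomp B hxB)
    simp only [hempty, Finset.coe_empty, Set.sUnion_empty, Submodule.span_empty,
      Submodule.mem_bot, smul_eq_zero, hm.ne', false_or] at hmx
    exact hA0 (hmx ▸ hBA hxB)
  obtain ⟨hcomplete, hdecomp⟩ := hS.2 F (fun D hD => ((hmemF D).mp hD).prop.1) hne (by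
    intro p hp q hq hpq
    have hp' := (hmemF p).mp hp
    have hq' := (hmemF q).mp hq
    exact ⟨fun h => hpq (hp'.eq_of_le hq'.prop h), fun h => hpq (hq'.eq_of_le hp'.prop h).symm⟩)
  have hunion : ⋃₀ (F : Set (Set Λ)) = B := by
    apply Set.Subset.antisymm
    · exact Set.sUnion_subset fun D hD => ((hmemF D).mp hD).prop.2.subset
    · intro y hy
      rw [hcomplete]
      exact ⟨hBA hy, zcomp_subset_inCSpan _ (hle (subset_zcomp B hy))⟩
  rw [hunion] at hdecomp
  refine hirr ⟨F, ?_, hdecomp⟩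
  by_contra! hcard
  obtain ⟨D, hD⟩ := Finset.card_eq_one.mp (le_antisymm (by omega) hne.card_pos)
  have hDF : D ∈ F := hD ▸ Finset.mem_singleton_self D
  rw [hD, Finset.coe_singleton, Set.sUnion_singleton] at hunion
  exact ((hmemF D).mp hDF).prop.2.ne hunion
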